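/- For every fixed 0<ℏ≤1, the C*-subalgebra of the bounded operators on L²(ℝⁿ₊) generated by the set { ρ_ℏ(f) + κ_ℏ(K) : f ∈ C_c^∞(ℝⁿ×ℝⁿ), K a smooth compactly supported function on ℝ^{n−1}×ℝ^{n−1}×ℝ₊×ℝ₊ } is exactly the algebra of all compact operators on L²(ℝⁿ₊). -/

import Mathlib

open MeasureTheory Filter Topology Set
open scoped ContDiff

noncomputable section

/-- `ℝ^{n−1}`, the boundary directions. -/
abbrev Eb (n : ℕ) : Type := Fin (n - 1) → ℝ

/-- `ℝⁿ` written as `ℝ^{n−1} × ℝ`; a point is `x = (x', xₙ)`. -/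
abbrev Ef (n : ℕ) : Type := Eb n × ℝ

/-- Lebesgue measure restricted to the closed half-space `ℝⁿ₊ = {x : xₙ ≥ 0}`. -/
def muPlus (n : ℕ) : Measure (Ef n) := volume.restrict {p : Ef n | 0 ≤ p.2}

/-- `L²(ℝⁿ₊)`. -/
abbrev HS (n : ℕ) := Lp ℂ 2 (muPlus n)

/-- `T` is the ℏ-scaled truncated operator `ρ_ℏ(f)` on `L²(ℝⁿ₊)`:
`(ρ_ℏ(f)ξ)(x) = ∫_{v : xₙ ≥ ℏvₙ} f(x,v) ξ(x−ℏv) dv`. -/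
def rhoSpec (n : ℕ) (ℏ : ℝ) (f : Ef n × Ef n → ℂ) (T : HS n →L[ℂ] HS n) : Prop :=
  ∀ ξ : HS n, ⇑(T ξ) =ᵐ[muPlus n]
    fun x => ∫ v in {v : Ef n | ℏ * v.2 ≤ x.2},
      f (x, v) * (ξ (x.1 - ℏ • v.1, x.2 - ℏ * v.2))

/-- `S` is the ℏ-scaled Green-type operator `κ_ℏ(K)` on `L²(ℝⁿ₊)`:
`(κ_ℏ(K)ξ)(x',xₙ) = ∫_{ℝ^{n−1}} ∫₀^∞ K(x',y',xₙ/ℏ,yₙ) ξ(x'−ℏy', ℏyₙ) dyₙ dy'`. -/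
def kappaSpec (n : ℕ) (ℏ : ℝ) (K : Eb n × Eb n × ℝ × ℝ → ℂ) (S : HS n →L[ℂ] HS n) : Prop :=
  ∀ ξ : HS n, ⇑(S ξ) =ᵐ[muPlus n]
    fun x => ∫ y' : Eb n, ∫ yn in Ioi (0:ℝ),
      K (x.1, y', x.2 / ℏ, yn) * (ξ (x.1 - ℏ • y', ℏ * yn))

/-- The measure on `ℝⁿ₊ × ℝⁿ` (base point in the half-space, tangent vector free). -/
def muT (n : ℕ) : Measure (Ef n × Ef n) := (muPlus n).prod volume

/-- `L²(ℝⁿ₊ × ℝⁿ)`. -/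
abbrev HT (n : ℕ) := Lp ℂ 2 (muT n)

/-- `P` is the fiberwise convolution operator `π₀(f)` on `L²(ℝⁿ₊×ℝⁿ)`:
`(π₀(f)ξ)(x,v) = ∫ f(x,w) ξ(x,v−w) dw`. -/
def pi0Spec (n : ℕ) (f : Ef n × Ef n → ℂ) (P : HT n →L[ℂ] HT n) : Prop :=
  ∀ ξ : HT n, ⇑(P ξ) =ᵐ[muT n] fun p => ∫ w : Ef n, f (p.1, w) * (ξ (p.1, p.2 - w))

/-- Lebesgue measure on `ℝ^{n−1} × ℝ^{n−1} × ℝ` restricted to `ℝ^{n−1} × ℝ^{n−1} × ℝ₊`. -/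
def muB (n : ℕ) : Measure (Eb n × Eb n × ℝ) :=
  volume.restrict {q : Eb n × Eb n × ℝ | 0 ≤ q.2.2}

/-- `L²(ℝ^{n−1} × ℝ^{n−1} × ℝ₊)`. -/
abbrev HB (n : ℕ) := Lp ℂ 2 (muB n)

/-- `B` is the boundary operator `π₀^∂(f⊕K)` on `L²(ℝ^{n−1}×ℝ^{n−1}×ℝ₊)`:
`(π₀^∂(f⊕K)ξ)(x',v',vₙ) = ∫_{ℝ^{n−1}} ∫₀^∞ [f(x',0,v'−w',vₙ−wₙ) + K(x',v'−w',vₙ,wₙ)]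
ξ(x',w',wₙ) dwₙ dw'`. -/
def piBSpec (n : ℕ) (f : Ef n × Ef n → ℂ) (K : Eb n × Eb n × ℝ × ℝ → ℂ)
    (B : HB n →L[ℂ] HB n) : Prop :=
  ∀ ξ : HB n, ⇑(B ξ) =ᵐ[muB n]
    fun q => ∫ w' : Eb n, ∫ wn in Ioi (0:ℝ),
      (f ((q.1, (0:ℝ)), (q.2.1 - w', q.2.2 - wn)) + K (q.1, q.2.1 - w', q.2.2, wn)) *
        (ξ (q.1, w', wn))

/-- Fiberwise convolution `(f*g)(x,w) = ∫ f(x,v) g(x,w−v) dv`. -/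
def fconv (n : ℕ) (f g : Ef n × Ef n → ℂ) : Ef n × Ef n → ℂ :=
  fun p => ∫ v : Ef n, f (p.1, v) * g (p.1, p.2 - v)

/-- The Green symbol `l(f,g)(x',y',xₙ,yₙ) =
−∫_{ℝ^{n−1}} ∫_{xₙ}^∞ f(x',0,y'−v',vₙ) g(x',0,v',xₙ−vₙ−yₙ) dvₙ dv'`. -/
def lGreen (n : ℕ) (f g : Ef n × Ef n → ℂ) : Eb n × Eb n × ℝ × ℝ → ℂ :=
  fun q => -(∫ v' : Eb n, ∫ vn in Ici q.2.2.1,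
    f ((q.1, (0:ℝ)), (q.2.1 - v', vn)) * g ((q.1, (0:ℝ)), (v', q.2.2.1 - vn - q.2.2.2)))


section abstractPart
variable {H : Type*} [NormedAddCommGroup H] [InnerProductSpace ℂ H] [CompleteSpace H]

lemma rankOne_compact (g h : H) : IsCompactOperator ⇑(InnerProductSpace.rankOne ℂ g h) := by
  rw [InnerProductSpace.rankOne_def']
  have h1 : IsCompactOperator (⇑(innerSL ℂ h)) :=
    isCompactOperator_of_locallyCompactSpace_dom _
  exact h1.clm_comp (ContinuousLinearMap.toSpanSingleton ℂ g)

lemma compact_mem_closure (A : H →L[ℂ] H) (hA : IsCompactOperator ⇑A)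
    (V : Submodule ℂ (H →L[ℂ] H)) (hV : IsClosed (V : Set (H →L[ℂ] H)))
    (hr : ∀ g h : H, InnerProductSpace.rankOne ℂ g h ∈ V) : A ∈ V := by
  have : A ∈ closure (V : Set (H →L[ℂ] H)) := by
    rw [Metric.mem_closure_iff]
    intro ε hε
    obtain ⟨C, hC, hsub⟩ := IsCompactOperator.image_closedBall_subset_compact
      (f := (A : H →ₗ[ℂ] H)) hA 1
    obtain ⟨t, htf, hts⟩ := Metric.totallyBounded_iff.1 hC.totallyBounded (ε/2) (by positivity)
    let U := Submodule.span ℂ t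
    have : FiniteDimensional ℂ U := FiniteDimensional.span_of_finite ℂ htf
    refine ⟨U.starProjection ∘L A, ?_, ?_⟩
    · rw [(stdOrthonormalBasis ℂ U).starProjection_eq_sum_rankOne]
      rw [ContinuousLinearMap.finsetSum_comp]
      refine Submodule.sum_mem _ fun i _ => ?_
      rw [InnerProductSpace.rankOne_comp]
      exact hr _ _
    · rw [dist_eq_norm]
      refine lt_of_le_of_lt ?_ (half_lt_self hε)
      refine ContinuousLinearMap.opNorm_le_of_unit_norm (by positivity) fun x hx => ?_
      have hx' : A x ∈ C := hsub ⟨x, by simp [hx], rfl⟩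
      obtain ⟨y, hy, hxy⟩ := mem_iUnion₂.1 (hts hx')
      have hyU : y ∈ U := Submodule.subset_span hy
      have h1 := U.starProjection_minimal (A x)
      simp only [sub_apply, ContinuousLinearMap.comp_apply]
      rw [h1]
      refine (ciInf_le ⟨0, ?_⟩ (⟨y, hyU⟩ : U)).trans ?_
      · rintro _ ⟨z, rfl⟩; positivity
      · rw [Metric.mem_ball, dist_eq_norm] at hxy
        exact hxy.le
  rwa [hV.closure_eq] at this

lemma compact_star (A : H →L[ℂ] H) (hA : IsCompactOperator ⇑A) :
    IsCompactOperator ⇑(star A) := by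
  let V : Submodule ℂ (H →L[ℂ] H) :=
    { carrier := {B | IsCompactOperator ⇑(star B)}
      add_mem' := by
        intro a b ha hb
        simp only [mem_ofPred_eq, star_add] at *
        exact ha.add hb
      zero_mem' := by
        simp only [mem_ofPred_eq, star_zero]
        exact isCompactOperator_zero
      smul_mem' := by
        intro c a ha
        simp only [mem_ofPred_eq, star_smul] at *
        exact ha.smul (star c) }
  refine compact_mem_closure A hA V ?_ ?_
  · exact isClosed_setOfPred_isCompactOperator.preimage continuous_star
  · intro g h
    change IsCompactOperator _
    rw [ContinuousLinearMap.star_eq_adjoint, InnerProductSpace.adjoint_rankOne]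
    exact rankOne_compact _ _

lemma closure_eq_compact (s : Set (H →L[ℂ] H)) (hs : ∀ A ∈ s, IsCompactOperator ⇑A)
    (D : Set H) (hD : Dense D)
    (hr : ∀ g ∈ D, ∀ h ∈ D, InnerProductSpace.rankOne ℂ g h ∈ s) :
    ((NonUnitalStarAlgebra.adjoin ℂ s).topologicalClosure : Set (H →L[ℂ] H))
      = {A : H →L[ℂ] H | IsCompactOperator ⇑A} := by
  apply Subset.antisymm
  · change closure _ ⊆ _
    refine closure_minimal ?_ isClosed_setOfPred_isCompactOperator
    intro A hA
    induction hA using NonUnitalStarAlgebra.adjoin_induction with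
    | mem x hx => exact hs x hx
    | add x y _ _ hx hy => exact IsCompactOperator.add hx hy
    | zero => exact isCompactOperator_zero
    | mul x y _ _ hx hy => exact IsCompactOperator.clm_comp hy x
    | smul r x _ hx => exact IsCompactOperator.smul hx r
    | star x _ hx => exact compact_star x hx
  · intro A hA
    let W := (NonUnitalStarAlgebra.adjoin ℂ s).topologicalClosure
    let V : Submodule ℂ (H →L[ℂ] H) :=
      { carrier := W
        add_mem' := fun ha hb => add_mem ha hb
        zero_mem' := zero_mem W
        smul_mem' := fun c a ha => SMulMemClass.smul_mem c ha }
    have hV : IsClosed (V : Set (H →L[ℂ] H)) :=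
      NonUnitalStarSubalgebra.isClosed_topologicalClosure _
    refine compact_mem_closure A hA V hV ?_
    have h0 : ∀ g ∈ D, ∀ h ∈ D, InnerProductSpace.rankOne ℂ g h ∈ V := fun g hg h hh =>
      NonUnitalStarSubalgebra.le_topologicalClosure _
        (NonUnitalStarAlgebra.subset_adjoin ℂ s (hr g hg h hh))
    have h1 : ∀ g ∈ D, ∀ h, InnerProductSpace.rankOne ℂ g h ∈ V := by
      intro g hg h
      have hc : IsClosed {h : H | InnerProductSpace.rankOne ℂ g h ∈ V} :=
        hV.preimage (InnerProductSpace.rankOne ℂ g).continuous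
      exact hc.closure_subset_iff.2 (fun h hh => h0 g hg h hh) (hD h)
    intro g h
    have hc : IsClosed {g : H | InnerProductSpace.rankOne ℂ g h ∈ V} :=
      hV.preimage (f := fun g => InnerProductSpace.rankOne ℂ g h) (by fun_prop)
    exact hc.closure_subset_iff.2 (fun g hg => h1 g hg h) (hD g)

end abstractPart

section kernelPart
variable {X : Type*} [MeasurableSpace X] {μ : Measure X}

lemma opNorm_le_of_inner (T : Lp ℂ 2 μ →L[ℂ] Lp ℂ 2 μ) (Φ : X → Lp ℂ 2 μ) (hΦ : MemLp Φ 2 μ)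
    (hT : ∀ ξ, ⇑(T ξ) =ᵐ[μ] fun x => inner ℂ (Φ x) ξ) :
    ‖T‖ ≤ (eLpNorm Φ 2 μ).toReal := by
  refine ContinuousLinearMap.opNorm_le_bound _ ENNReal.toReal_nonneg fun ξ => ?_
  have : ‖T ξ‖ ≤ ‖ξ‖ * ‖hΦ.toLp Φ‖ := by
    refine Lp.norm_le_mul_norm_of_ae_le_mul ?_
    filter_upwards [hT ξ, hΦ.coeFn_toLp] with x h1 h2
    rw [h1, h2, mul_comm]
    exact norm_inner_le_norm _ _
  rw [mul_comm]
  simpa using this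

lemma compact_of_inner (T : Lp ℂ 2 μ →L[ℂ] Lp ℂ 2 μ) (Φ : X → Lp ℂ 2 μ) (hΦ : MemLp Φ 2 μ)
    (hT : ∀ ξ, ⇑(T ξ) =ᵐ[μ] fun x => inner ℂ (Φ x) ξ) : IsCompactOperator ⇑T := by
  classical
  have : T ∈ closure {A : Lp ℂ 2 μ →L[ℂ] Lp ℂ 2 μ | IsCompactOperator ⇑A} := by
    rw [Metric.mem_closure_iff]
    intro ε hε
    obtain ⟨s, hs, hsm⟩ := hΦ.exists_simpleFunc_eLpNorm_sub_lt (by simp)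
      (ε := ENNReal.ofReal ε) (by simpa using hε)
    let F : Finset (Lp ℂ 2 μ) := s.range.filter (fun c => c ≠ 0)
    have hfin : ∀ c ≠ 0, μ (s ⁻¹' {c}) ≠ ⊤ := fun c hc =>
      (SimpleFunc.measure_preimage_lt_top_of_memLp (by simp) (by simp) s hsm c hc).ne
    let A : Lp ℂ 2 μ →L[ℂ] Lp ℂ 2 μ := ∑ c ∈ F.attach,
      InnerProductSpace.rankOne ℂ
        (indicatorConstLp 2 (s.measurableSet_preimage {c.1})
          (hfin c.1 (Finset.mem_filter.1 c.2).2) (1:ℂ)) c.1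
    refine ⟨A, ?_, ?_⟩
    · have : A ∈ compactOperator (RingHom.id ℂ) (Lp ℂ 2 μ) (Lp ℂ 2 μ) :=
        Submodule.sum_mem _ fun c _ => rankOne_compact _ _
      exact this
    · rw [dist_eq_norm]
      have hA : ∀ ξ, ⇑(A ξ) =ᵐ[μ] fun x => inner ℂ (s x) ξ := by
        intro ξ
        have h1 : A ξ = ∑ c ∈ F.attach, (inner ℂ c.1 ξ) •
          (indicatorConstLp 2 (s.measurableSet_preimage {c.1})
          (hfin c.1 (Finset.mem_filter.1 c.2).2) (1:ℂ)) := by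
          simp [A]
        rw [h1]
        refine (Lp.coeFn_finsetSum _ _).trans ?_
        have h2 : ∀ᵐ x ∂μ, ∀ c : F, (((inner ℂ c.1 ξ) •
          (indicatorConstLp 2 (s.measurableSet_preimage {c.1})
          (hfin c.1 (Finset.mem_filter.1 c.2).2) (1:ℂ)) : Lp ℂ 2 μ) : X → ℂ) x
            = inner ℂ c.1 ξ * (s ⁻¹' {c.1}).indicator (fun _ => (1:ℂ)) x := by
          rw [ae_all_iff]
          intro c
          filter_upwards [Lp.coeFn_smul (inner ℂ c.1 ξ) (indicatorConstLp 2
            (s.measurableSet_preimage {c.1}) (hfin c.1 (Finset.mem_filter.1 c.2).2) (1:ℂ)),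
            indicatorConstLp_coeFn (p := 2) (hs := s.measurableSet_preimage {c.1})
              (hμs := hfin c.1 (Finset.mem_filter.1 c.2).2) (c := (1:ℂ))] with x h3 h4
          rw [h3, Pi.smul_apply, h4, smul_eq_mul]
        filter_upwards [h2] with x hx
        rw [Finset.sum_apply, Finset.sum_congr rfl fun c _ => hx c,
          Finset.sum_attach F (fun c => inner ℂ c ξ * (s ⁻¹' {c}).indicator (fun _ => (1:ℂ)) x)]
        by_cases h0 : s x = 0
        · rw [h0, inner_zero_left]
          refine Finset.sum_eq_zero fun c hc => ?_
          have : c ≠ 0 := (Finset.mem_filter.1 hc).2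
          simp [indicator, h0, this.symm]
        · rw [Finset.sum_eq_single (s x)]
          · simp
          · intro b _ hb
            simp [indicator, hb.symm]
          · intro hn
            exact absurd (Finset.mem_filter.2 ⟨s.mem_range_self x, h0⟩) hn
      have := opNorm_le_of_inner (T - A) (Φ - s) (hΦ.sub hsm) (by
        intro ξ
        rw [sub_apply]
        filter_upwards [Lp.coeFn_sub (T ξ) (A ξ), hT ξ, hA ξ] with x h1 h2 h3
        rw [h1, Pi.sub_apply, h2, h3, Pi.sub_apply, inner_sub_left])
      refine this.trans_lt ?_
      rw [← ENNReal.toReal_ofReal hε.le]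
      exact (ENNReal.toReal_lt_toReal (hΦ.sub hsm).eLpNorm_ne_top (by simp)).2 hs
  rwa [isClosed_setOfPred_isCompactOperator.closure_eq] at this

end kernelPart

section contKernel
variable {X : Type*} [TopologicalSpace X] [T2Space X] [LocallyCompactSpace X]
  [SecondCountableTopology X] [MeasurableSpace X] [BorelSpace X] {μ : Measure X}
  [IsFiniteMeasureOnCompacts μ]

lemma slice_compact {k : X × X → ℂ} (hc : HasCompactSupport k) (x : X) :
    HasCompactSupport fun y => k (x, y) := by
  refine HasCompactSupport.intro (hc.image continuous_snd) fun y hy => ?_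
  by_contra h
  exact hy ⟨(x, y), subset_tsupport _ h, rfl⟩

lemma slice_memLp {k : X × X → ℂ} (hk : Continuous k) (hc : HasCompactSupport k) (x : X) :
    MemLp (fun y => k (x, y)) 2 μ :=
  Continuous.memLp_of_hasCompactSupport (by fun_prop) (slice_compact hc x)

lemma slice_continuous {k : X × X → ℂ} (hk : Continuous k) (hc : HasCompactSupport k) :
    Continuous fun x => (slice_memLp (μ := μ) hk hc x).toLp (fun y => k (x, y)) := by
  rw [continuous_iff_continuousAt]
  intro x₀
  have hcont : Continuous fun x => ∫ y in Prod.snd '' tsupport k, ‖k (x, y) - k (x₀, y)‖ ^ 2 ∂μ :=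
    continuous_parametric_integral_of_continuous (f := fun x y => ‖k (x, y) - k (x₀, y)‖ ^ 2)
      (by fun_prop) (hc.image continuous_snd)
  have hz : ∀ x y, y ∉ Prod.snd '' tsupport k → k (x, y) = 0 := by
    intro x y hy
    by_contra h
    exact hy ⟨(x, y), subset_tsupport _ h, rfl⟩
  have hn : ∀ x, ‖(slice_memLp (μ := μ) hk hc x).toLp (fun y => k (x, y)) -
      (slice_memLp (μ := μ) hk hc x₀).toLp (fun y => k (x₀, y))‖ ^ 2 =
      ∫ y in Prod.snd '' tsupport k, ‖k (x, y) - k (x₀, y)‖ ^ 2 ∂μ := by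
    intro x
    rw [setIntegral_eq_integral_of_forall_compl_eq_zero
      (fun y hy => by simp [hz x y hy, hz x₀ y hy]), ← MemLp.toLp_sub]
    rw [norm_sq_eq_re_inner (𝕜 := ℂ), L2.inner_def, integral_congr_ae
      (g := fun y => ((‖k (x, y) - k (x₀, y)‖ ^ 2 : ℝ) : ℂ)), integral_complex_ofReal]
    · exact Complex.ofReal_re _
    · filter_upwards [((slice_memLp (μ := μ) hk hc x).sub
        (slice_memLp (μ := μ) hk hc x₀)).coeFn_toLp] with y hy
      rw [hy, inner_self_eq_norm_sq_to_K]
      simp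
  rw [ContinuousAt, tendsto_iff_norm_sub_tendsto_zero]
  have h1 := hcont.tendsto x₀
  simp only [← hn, sub_self, norm_zero] at h1
  have h2 := h1.sqrt
  simpa using h2

lemma compact_of_kernel (k : X × X → ℂ) (hk : Continuous k) (hc : HasCompactSupport k)
    (T : Lp ℂ 2 μ →L[ℂ] Lp ℂ 2 μ)
    (hT : ∀ ξ : Lp ℂ 2 μ, ⇑(T ξ) =ᵐ[μ] fun x => ∫ y, k (x, y) * ξ y ∂μ) :
    IsCompactOperator ⇑T := by
  let k' : X × X → ℂ := fun p => star (k p)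
  have hk' : Continuous k' := hk.star
  have hc' : HasCompactSupport k' := hc.comp_left (g := star) (by simp)
  refine compact_of_inner T (fun x => (slice_memLp (μ := μ) hk' hc' x).toLp _) ?_ ?_
  · refine Continuous.memLp_of_hasCompactSupport (slice_continuous hk' hc') ?_
    refine HasCompactSupport.intro (hc'.image continuous_fst) fun x hx => ?_
    have : (fun y => k' (x, y)) = 0 := by
      ext y
      by_contra h
      exact hx ⟨(x, y), subset_tsupport _ h, rfl⟩
    simp only [this]
    exact MemLp.toLp_zero _
  · intro ξ
    filter_upwards [hT ξ] with x hx
    rw [hx, L2.inner_def]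
    refine integral_congr_ae ?_
    filter_upwards [(slice_memLp (μ := μ) hk' hc' x).coeFn_toLp] with y hy
    rw [hy]
    simp [k', mul_comm]

end contKernel

instance (n : ℕ) : IsFiniteMeasureOnCompacts (muPlus n) := by
  unfold muPlus; infer_instance

lemma measurableSet_half (n : ℕ) : MeasurableSet {p : Ef n | 0 ≤ p.2} :=
  measurableSet_le measurable_const measurable_snd

lemma muPlus_prod (n : ℕ) :
    muPlus n = (volume : Measure (Eb n)).prod (volume.restrict (Ioi (0:ℝ))) := by
  rw [muPlus, restrict_Ioi_eq_restrict_Ici]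
  rw [← Measure.restrict_univ (μ := (volume : Measure (Eb n))), Measure.prod_restrict,
    Measure.volume_eq_prod]
  congr 1
  ext p
  simp

instance haarEf (n : ℕ) : (volume : Measure (Ef n)).IsAddHaarMeasure := by
  rw [Measure.volume_eq_prod]; infer_instance

lemma change_var (n : ℕ) (ℏ : ℝ) (hℏ : 0 < ℏ) (x : Ef n) (F : Ef n → ℂ) :
    ∫ v in {v : Ef n | ℏ * v.2 ≤ x.2}, F (x - ℏ • v) =
      ((ℏ ^ Module.finrank ℝ (Ef n))⁻¹ : ℝ) • ∫ y, F y ∂(muPlus n) := by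
  rw [muPlus, ← integral_indicator (measurableSet_half n), ← integral_indicator
    (measurableSet_le (by fun_prop) (by fun_prop))]
  have h1 := Measure.integral_comp_smul (volume : Measure (Ef n))
    (fun w => ({p : Ef n | 0 ≤ p.2}.indicator F) (x - w)) ℏ
  rw [integral_sub_left_eq_self (μ := (volume : Measure (Ef n))), abs_of_pos (by positivity)] at h1
  rw [← h1]
  congr 1
  ext v
  simp [indicator]

lemma rho_compact (n : ℕ) (ℏ : ℝ) (hℏ : 0 < ℏ) (f : Ef n × Ef n → ℂ) (hf : Continuous f)
    (hc : HasCompactSupport f) (T : HS n →L[ℂ] HS n) (hT : rhoSpec n ℏ f T) :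
    IsCompactOperator ⇑T := by
  let c : ℝ := (ℏ ^ Module.finrank ℝ (Ef n))⁻¹
  let e : Ef n × Ef n ≃ₜ Ef n × Ef n :=
    { toFun := fun p => (p.1, ℏ⁻¹ • (p.1 - p.2))
      invFun := fun p => (p.1, p.1 - ℏ • p.2)
      left_inv := fun p => by ext <;> simp [hℏ.ne']
      right_inv := fun p => by ext <;> simp [hℏ.ne']
      continuous_toFun := by fun_prop
      continuous_invFun := by fun_prop }
  have hc1 : HasCompactSupport (f ∘ e) := hc.comp_homeomorph e
  refine compact_of_kernel (fun p => (c : ℂ) * (f ∘ e) p) (by fun_prop) (hc1.mul_left) T ?_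
  intro ξ
  filter_upwards [hT ξ] with x hx
  rw [hx]
  have := change_var n ℏ hℏ x (fun y => f (x, ℏ⁻¹ • (x - y)) * ξ y)
  simp only [sub_sub_cancel, smul_smul, inv_mul_cancel₀ hℏ.ne', one_smul] at this
  refine Eq.trans this ?_
  rw [← integral_smul]
  refine integral_congr_ae (Eventually.of_forall fun y => ?_)
  simp [e, c, mul_assoc]

lemma kappa_compact (n : ℕ) (ℏ : ℝ) (hℏ : 0 < ℏ) (K : Eb n × Eb n × ℝ × ℝ → ℂ)
    (hK : Continuous K) (hc : HasCompactSupport K) (S : HS n →L[ℂ] HS n)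
    (hS : kappaSpec n ℏ K S) : IsCompactOperator ⇑S := by
  let c : ℝ := (ℏ ^ Module.finrank ℝ (Eb n))⁻¹
  let e : Ef n × Ef n ≃ₜ Eb n × Eb n × ℝ × ℝ :=
    { toFun := fun p => (p.1.1, ℏ⁻¹ • (p.1.1 - p.2.1), p.1.2 / ℏ, ℏ⁻¹ * p.2.2)
      invFun := fun q => ((q.1, ℏ * q.2.2.1), (q.1 - ℏ • q.2.1, ℏ * q.2.2.2))
      left_inv := fun p => by ext <;> simp [hℏ.ne'] ; field_simp
      right_inv := fun p => by ext <;> simp [hℏ.ne']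
      continuous_toFun := by fun_prop
      continuous_invFun := by fun_prop }
  have hc1 : HasCompactSupport (K ∘ e) := hc.comp_homeomorph e
  have hk : Continuous (fun p => (c * ℏ⁻¹ : ℂ) * (K ∘ e) p) := by fun_prop
  have hkc : HasCompactSupport (fun p => (c * ℏ⁻¹ : ℂ) * (K ∘ e) p) := hc1.mul_left
  refine compact_of_kernel (fun p => (c * ℏ⁻¹ : ℂ) * (K ∘ e) p) hk hkc S ?_
  intro ξ
  filter_upwards [hS ξ] with x hx
  rw [hx]
  have hInt : Integrable (fun y => (c * ℏ⁻¹ : ℂ) * (K ∘ e) (x, y) * ξ y) (muPlus n) :=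
    MemLp.integrable_mul (slice_memLp hk hkc x) (Lp.memLp ξ)
  have hIntProd : Integrable (fun y => (c * ℏ⁻¹ : ℂ) * (K ∘ e) (x, y) * ξ y)
      ((volume : Measure (Eb n)).prod (volume.restrict (Ioi (0:ℝ)))) :=
    by
    convert! hInt using 1
    exact (muPlus_prod n).symm
  have h1 : ∫ y, (c * ℏ⁻¹ : ℂ) * (K ∘ e) (x, y) * ξ y ∂(muPlus n) =
      ∫ y' : Eb n, ∫ yn in Ioi (0:ℝ), (c * ℏ⁻¹ : ℂ) * (K ∘ e) (x, (y', yn)) * ξ (y', yn) := by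
    rw [← integral_prod _ hIntProd]
    exact congrArg (fun m => ∫ y, (c * ℏ⁻¹ : ℂ) * (K ∘ e) (x, y) * ξ y ∂m) (muPlus_prod n)
  rw [h1]
  have h2 : ∀ y' : Eb n, ∫ yn in Ioi (0:ℝ), K (x.1, y', x.2 / ℏ, yn) * ξ (x.1 - ℏ • y', ℏ * yn) =
      ℏ⁻¹ • ∫ yn in Ioi (0:ℝ), K (x.1, y', x.2 / ℏ, ℏ⁻¹ * yn) * ξ (x.1 - ℏ • y', yn) := by
    intro y'
    have := integral_comp_mul_left_Ioi
      (fun yn => K (x.1, y', x.2 / ℏ, ℏ⁻¹ * yn) * ξ (x.1 - ℏ • y', yn)) 0 hℏ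
    simpa [← mul_assoc, inv_mul_cancel₀ hℏ.ne'] using this
  simp only [h2]
  have h3 := Measure.integral_comp_smul (volume : Measure (Eb n))
    (fun w => ℏ⁻¹ • ∫ yn in Ioi (0:ℝ), K (x.1, ℏ⁻¹ • w, x.2 / ℏ, ℏ⁻¹ * yn) * ξ (x.1 - w, yn)) ℏ
  simp only [smul_smul, inv_mul_cancel₀ hℏ.ne', one_smul] at h3
  rw [h3, abs_of_pos (by positivity),
    ← integral_sub_left_eq_self (μ := (volume : Measure (Eb n))) _ x.1, ← integral_smul]
  refine integral_congr_ae (Eventually.of_forall fun y => ?_)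
  simp only [sub_sub_cancel, smul_smul]
  rw [← integral_smul]
  refine integral_congr_ae (Eventually.of_forall fun yn => ?_)
  simp [e, c, mul_assoc]

lemma rank_rho (n : ℕ) (ℏ : ℝ) (hℏ : 0 < ℏ) (G E : HS n) (g h : Ef n → ℂ)
    (hg : G =ᵐ[muPlus n] g) (hh : E =ᵐ[muPlus n] h)
    (hgc : HasCompactSupport g) (hgs : ContDiff ℝ ∞ g)
    (hhc : HasCompactSupport h) (hhs : ContDiff ℝ ∞ h) :
    ∃ f : Ef n × Ef n → ℂ, ContDiff ℝ ∞ f ∧ HasCompactSupport f ∧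
      rhoSpec n ℏ f (InnerProductSpace.rankOne ℂ G E) := by
  let c : ℝ := ℏ ^ Module.finrank ℝ (Ef n)
  let e : Ef n × Ef n ≃ₜ Ef n × Ef n :=
    { toFun := fun p => (p.1, p.1 - ℏ • p.2)
      invFun := fun p => (p.1, ℏ⁻¹ • (p.1 - p.2))
      left_inv := fun p => by ext <;> simp [hℏ.ne']
      right_inv := fun p => by ext <;> simp [hℏ.ne']
      continuous_toFun := by fun_prop
      continuous_invFun := by fun_prop }
  have h0 : HasCompactSupport (fun p : Ef n × Ef n => (c : ℂ) * (g p.1 * star (h p.2))) := by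
    refine HasCompactSupport.intro (hgc.prod hhc) fun p hp => ?_
    by_contra hne
    refine hp ⟨subset_tsupport _ ?_, subset_tsupport _ ?_⟩
    · intro h1; simp [h1] at hne
    · intro h1; simp [h1] at hne
  refine ⟨(fun p : Ef n × Ef n => (c : ℂ) * (g p.1 * star (h p.2))) ∘ e, ?_,
    h0.comp_homeomorph e, ?_⟩
  · change ContDiff ℝ ∞ fun p : Ef n × Ef n => (c : ℂ) * (g p.1 * Complex.conjCLE (h (p.1 - ℏ • p.2)))
    fun_prop
  · intro ξ
    rw [InnerProductSpace.rankOne_apply]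
    filter_upwards [Lp.coeFn_smul (inner ℂ E ξ) G, hg] with x h1 h2
    rw [h1, Pi.smul_apply, h2]
    have := change_var n ℏ hℏ x (fun y => (c : ℂ) * (g x * star (h y)) * ξ y)
    refine Eq.trans ?_ this.symm
    rw [L2.inner_def, smul_eq_mul, ← integral_mul_const, ← integral_smul]
    refine integral_congr_ae ?_
    filter_upwards [hh] with y hy
    have hc : (c : ℂ) ≠ 0 := by
      simp only [c]; exact_mod_cast (pow_pos hℏ _).ne'
    rw [hy]
    have hc2 : (ℏ ^ Module.finrank ℝ (Ef n))⁻¹ = c⁻¹ := rfl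
    rw [hc2, Complex.real_smul, Complex.ofReal_inv, RCLike.inner_apply]
    simp only [RCLike.star_def]
    field_simp

/-- For every fixed `0<ℏ≤1`, the C*-subalgebra of the bounded operators on `L²(ℝⁿ₊)`
generated by all operators `ρ_ℏ(f)+κ_ℏ(K)` with `f ∈ C_c^∞(ℝⁿ×ℝⁿ)` and `K` a smooth
compactly supported kernel (i.e. the topological closure of the non-unital star
subalgebra they generate) is exactly the algebra of all compact operators on `L²(ℝⁿ₊)`. -/
theorem statement19 (n : ℕ) (hn : 1 ≤ n) (ℏ : ℝ) (hℏ : ℏ ∈ Ioc (0:ℝ) 1) :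
    ((NonUnitalStarAlgebra.adjoin ℂ
        {A : HS n →L[ℂ] HS n |
          ∃ (f : Ef n × Ef n → ℂ) (K : Eb n × Eb n × ℝ × ℝ → ℂ)
            (T S : HS n →L[ℂ] HS n),
            ContDiff ℝ ∞ f ∧ HasCompactSupport f ∧
            ContDiff ℝ ∞ K ∧ HasCompactSupport K ∧
            rhoSpec n ℏ f T ∧ kappaSpec n ℏ K S ∧ A = T + S}).topologicalClosure :
      Set (HS n →L[ℂ] HS n))
      = {A : HS n →L[ℂ] HS n | IsCompactOperator ⇑A} := by
  refine closure_eq_compact _ ?_ {F : HS n | ∃ g : Ef n → ℂ, F =ᵐ[muPlus n] g ∧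
    HasCompactSupport g ∧ ContDiff ℝ ∞ g} (Lp.dense_hasCompactSupport_contDiff (by simp)) ?_
  · rintro A ⟨f, K, T, S, hf, hfc, hK, hKc, hT, hS, rfl⟩
    exact (rho_compact n ℏ hℏ.1 f hf.continuous hfc T hT).add
      (kappa_compact n ℏ hℏ.1 K hK.continuous hKc S hS)
  · rintro G ⟨g, hg, hgc, hgs⟩ E ⟨h, hh, hhc, hhs⟩
    obtain ⟨f, hf, hfc, hfT⟩ := rank_rho n ℏ hℏ.1 G E g h hg hh hgc hgs hhc hhs
    refine ⟨f, 0, _, 0, hf, hfc, contDiff_const, HasCompactSupport.zero, hfT, ?_, (add_zero _).symm⟩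
    intro ξ
    filter_upwards [Lp.coeFn_zero ℂ 2 (muPlus n)] with x hx
    simpa using hx
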